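/- Let (T, Σ_C) be a safe DL-Lite_R TBox with closed predicates. Then for every UCQ q(x⃗), the OMQC (T, Σ_C, q) (with ABox signature all of N_C ∪ N_R) is FO-rewritable: there is a first-order formula p(x⃗) over concept and role names (with equality) such that for all ABoxes A and all tuples a⃗ from Ind(A), I_A ⊨ p(a⃗) iff A ⊨ (T, Σ_C, q)(a⃗). -/

import Mathlib

namespace DL

/-- Roles: role names or inverse roles.  Role names are natural numbers. -/
inductive Role : Type
  | nm (r : ℕ) : Role
  | inv (r : ℕ) : Role
  deriving DecidableEq

/-- The inverse of a role. -/
def Role.flip : Role → Role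
  | .nm r => .inv r
  | .inv r => .nm r

/-- The role name occurring in a role. -/
def Role.name : Role → ℕ
  | .nm r => r
  | .inv r => r

/-- Interpretations.  Concept names, role names, and individual names are natural
numbers.  The standard name assumption is modelled by a partial, injective
interpretation `ind` of individual names: `ind a = some d` means that the individual
name `a` belongs to the domain and is (identified with) the element `d`. -/
structure Interp : Type 1 where
  Dom : Type
  dne : Nonempty Dom
  ind : ℕ → Option Dom
  ind_inj : ∀ a b d, ind a = some d → ind b = some d → a = b
  cInt : ℕ → Set Dom
  rInt : ℕ → Set (Dom × Dom)

/-- Extension of a (possibly inverse) role. -/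
def Interp.rI (I : Interp) : Role → Set (I.Dom × I.Dom)
  | .nm r => I.rInt r
  | .inv r => {p | (p.2, p.1) ∈ I.rInt r}

/-- ABoxes: sets of concept assertions `(A, a)` and role assertions `(r, a, b)`. -/
structure ABox : Type where
  ca : Set (ℕ × ℕ)
  ra : Set (ℕ × ℕ × ℕ)

/-- The individual names occurring in an ABox. -/
def ABox.ind (A : ABox) : Set ℕ :=
  {a | (∃ p ∈ A.ca, p.2 = a) ∨ (∃ t ∈ A.ra, t.2.1 = a ∨ t.2.2 = a)}

/-- The ABox is finite. -/
def ABox.Fin (A : ABox) : Prop := A.ca.Finite ∧ A.ra.Finite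

/-- The ABox only uses concept names from `Sc` and role names from `Sr`
(i.e. it is a `S`-ABox for the signature `S = Sc ∪ Sr`). -/
def ABox.usesOnly (A : ABox) (Sc Sr : Set ℕ) : Prop :=
  (∀ p ∈ A.ca, p.1 ∈ Sc) ∧ (∀ t ∈ A.ra, t.1 ∈ Sr)

/-- `I` is a model of the ABox `A` (under the standard name assumption). -/
def Interp.modelA (I : Interp) (A : ABox) : Prop :=
  (∀ p ∈ A.ca, ∃ d, I.ind p.2 = some d ∧ d ∈ I.cInt p.1) ∧
  (∀ t ∈ A.ra, ∃ d e, I.ind t.2.1 = some d ∧ I.ind t.2.2 = some e ∧ (d, e) ∈ I.rInt t.1)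

/-- `I` respects the closed predicates `Sc` (concept names) and `Sr` (role names)
with respect to the ABox `A`: the extension of each closed predicate is exactly
what is asserted in `A`. -/
def Interp.respects (I : Interp) (A : ABox) (Sc Sr : Set ℕ) : Prop :=
  (∀ B ∈ Sc, ∀ d, d ∈ I.cInt B ↔ ∃ a, I.ind a = some d ∧ (B, a) ∈ A.ca) ∧
  (∀ r ∈ Sr, ∀ d e, (d, e) ∈ I.rInt r ↔ ∃ a b, I.ind a = some d ∧ I.ind b = some e ∧ (r, a, b) ∈ A.ra)

/-- First-order queries built from concept atoms, role atoms and equality using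
negation, conjunction, disjunction and existential quantification.
Variables are natural numbers. -/
inductive FO : Type
  | eq (x y : ℕ)
  | capp (B x : ℕ)
  | rapp (r x y : ℕ)
  | neg (φ : FO)
  | conj (φ ψ : FO)
  | disj (φ ψ : FO)
  | ex (x : ℕ) (φ : FO)

/-- Standard first-order evaluation of a query in an interpretation under an
assignment. -/
def Interp.evalFO (I : Interp) : (ℕ → I.Dom) → FO → Prop
  | v, .eq x y => v x = v y
  | v, .capp B x => v x ∈ I.cInt B
  | v, .rapp r x y => (v x, v y) ∈ I.rInt r
  | v, .neg φ => ¬ I.evalFO v φ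
  | v, .conj φ ψ => I.evalFO v φ ∧ I.evalFO v ψ
  | v, .disj φ ψ => I.evalFO v φ ∨ I.evalFO v ψ
  | v, .ex x φ => ∃ d : I.Dom, I.evalFO (Function.update v x d) φ

/-- Free variables of a first-order query. -/
def FO.free : FO → Set ℕ
  | .eq x y => {x, y}
  | .capp _ x => {x}
  | .rapp _ x y => {x, y}
  | .neg φ => φ.free
  | .conj φ ψ => φ.free ∪ ψ.free
  | .disj φ ψ => φ.free ∪ ψ.free
  | .ex x φ => φ.free \ {x}

/-- Conjunctions of concept and role atoms. -/
inductive IsConjAtoms : FO → Prop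
  | capp (B x : ℕ) : IsConjAtoms (.capp B x)
  | rapp (r x y : ℕ) : IsConjAtoms (.rapp r x y)
  | conj {φ ψ : FO} : IsConjAtoms φ → IsConjAtoms ψ → IsConjAtoms (.conj φ ψ)

/-- Conjunctive queries: existentially quantified conjunctions of atoms. -/
inductive IsCQ : FO → Prop
  | base {φ : FO} : IsConjAtoms φ → IsCQ φ
  | ex {φ : FO} (x : ℕ) : IsCQ φ → IsCQ (.ex x φ)

/-- Unions of conjunctive queries: disjunctions of CQs. -/
inductive IsUCQ : FO → Prop
  | base {φ : FO} : IsCQ φ → IsUCQ φ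
  | disj {φ ψ : FO} : IsUCQ φ → IsUCQ ψ → IsUCQ (.disj φ ψ)

/-- `v` maps the answer variables `xs` to (the domain elements named by) the
individual names `as`. -/
def matches' (I : Interp) (xs as : List ℕ) (v : ℕ → I.Dom) : Prop :=
  ∀ p ∈ List.zip xs as, I.ind p.2 = some (v p.1)

/-- `I ⊨ q(as)`, where `xs` is the list of answer variables of `q`. -/
def Interp.sat (I : Interp) (q : FO) (xs as : List ℕ) : Prop :=
  ∃ v : ℕ → I.Dom, matches' I xs as v ∧ I.evalFO v q

/-- Certain answers of the ontology-mediated query with closed predicates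
`(T, Σ_C, q)` where the models of the TBox `T` are given by the predicate `mod`:
`as` is a certain answer to `q` (with answer variables `xs`) over `A` iff every
model of the TBox and `A` that respects the closed predicates satisfies `q(as)`. -/
def certAns (mod : Interp → Prop) (Sc Sr : Set ℕ) (A : ABox) (q : FO) (xs as : List ℕ) : Prop :=
  ∀ I : Interp, mod I → I.modelA A → I.respects A Sc Sr → I.sat q xs as

/-- `A` is consistent w.r.t. the TBox (given by `mod`) and the closed predicates. -/
def consistentW (mod : Interp → Prop) (Sc Sr : Set ℕ) (A : ABox) : Prop :=
  ∃ I : Interp, mod I ∧ I.modelA A ∧ I.respects A Sc Sr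

/-- DL-Lite basic concepts: concept names and unqualified existential
restrictions `∃ρ` over (possibly inverse) roles. -/
inductive Basic : Type
  | atom (B : ℕ)
  | ex (ρ : Role)
  deriving DecidableEq

/-- Semantics of basic concepts. -/
def Interp.semB (I : Interp) : Basic → Set I.Dom
  | .atom B => I.cInt B
  | .ex ρ => {d | ∃ e, (d, e) ∈ I.rI ρ}

/-- DL-Lite_R axioms: positive and negative concept inclusions between
basic concepts, and role inclusions. -/
inductive LiteAx : Type
  | pos (B₁ B₂ : Basic)
  | npos (B₁ B₂ : Basic)
  | ri (ρ σ : Role)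

/-- A DL-Lite_R TBox is a finite list of axioms. -/
abbrev LiteTBox := List LiteAx

/-- `I` is a model of the DL-Lite_R TBox `T`. -/
def Interp.modelLite (I : Interp) (T : LiteTBox) : Prop :=
  (∀ B₁ B₂ : Basic, LiteAx.pos B₁ B₂ ∈ T → I.semB B₁ ⊆ I.semB B₂) ∧
  (∀ B₁ B₂ : Basic, LiteAx.npos B₁ B₂ ∈ T → I.semB B₁ ∩ I.semB B₂ = ∅) ∧
  (∀ ρ σ : Role, LiteAx.ri ρ σ ∈ T → I.rI ρ ⊆ I.rI σ)

/-- `T ⊨ B₁ ⊑ B₂`. -/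
def liteEntPos (T : LiteTBox) (B₁ B₂ : Basic) : Prop :=
  ∀ I : Interp, I.modelLite T → I.semB B₁ ⊆ I.semB B₂

/-- `T ⊨ B₁ ⊑ ¬B₂`. -/
def liteEntNeg (T : LiteTBox) (B₁ B₂ : Basic) : Prop :=
  ∀ I : Interp, I.modelLite T → I.semB B₁ ∩ I.semB B₂ = ∅

/-- `T ⊨ ρ ⊑ σ`. -/
def liteEntRI (T : LiteTBox) (ρ σ : Role) : Prop :=
  ∀ I : Interp, I.modelLite T → I.rI ρ ⊆ I.rI σ

/-- `B` is satisfiable w.r.t. `T`. -/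
def liteSat (T : LiteTBox) (B : Basic) : Prop :=
  ∃ I : Interp, I.modelLite T ∧ (I.semB B).Nonempty

/-- Concept names occurring in a basic concept. -/
def Basic.sigC : Basic → Set ℕ
  | .atom B => {B}
  | .ex _ => ∅

/-- Role names occurring in a basic concept. -/
def Basic.sigR : Basic → Set ℕ
  | .atom _ => ∅
  | .ex ρ => {ρ.name}

/-- Safeness of a DL-Lite_R TBox with closed predicates `(T, S_C)` where
`S_C` consists of the concept names `Sc` and the role names `Sr`. -/
def LiteSafe (T : LiteTBox) (Sc Sr : Set ℕ) : Prop :=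
  ¬ ∃ (B₁ B₂ : Basic) (ρ : Role),
      liteSat T B₁ ∧
      liteEntPos T B₁ (.ex ρ) ∧ liteEntPos T (.ex ρ.flip) B₂ ∧
      (∀ ρ' : Role, liteEntRI T ρ' ρ → B₁ ≠ .ex ρ') ∧
      (B₂.sigC ⊆ Sc ∧ B₂.sigR ⊆ Sr) ∧
      (∀ ρ' : Role, liteEntPos T B₁ (.ex ρ') → liteEntRI T ρ' ρ → ρ'.name ∉ Sr)

/-- Active-domain evaluation of a first-order query over (the interpretation
`I_A` corresponding to) an ABox: quantifiers range over `Ind(A)`. -/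
def ABox.evalFO (A : ABox) : (ℕ → ℕ) → FO → Prop
  | v, .eq x y => v x = v y
  | v, .capp B x => (B, v x) ∈ A.ca
  | v, .rapp r x y => (r, v x, v y) ∈ A.ra
  | v, .neg φ => ¬ A.evalFO v φ
  | v, .conj φ ψ => A.evalFO v φ ∧ A.evalFO v ψ
  | v, .disj φ ψ => A.evalFO v φ ∨ A.evalFO v ψ
  | v, .ex x φ => ∃ a ∈ A.ind, A.evalFO (Function.update v x a) φ

/-- `I_A ⊨ p(as)` where `xs` are the answer variables of `p`. -/
def ABox.satFO (A : ABox) (p : FO) (xs as : List ℕ) : Prop :=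
  ∃ v : ℕ → ℕ, (∀ pr ∈ List.zip xs as, v pr.1 = pr.2) ∧ A.evalFO v p

/-- FO-rewritability of an ontology-mediated query whose certain answers are
given by `certain`, over the admissible ABoxes: there is a first-order formula
`p` with free variables among the answer variables `xs` such that for all
admissible ABoxes `A` and all tuples `as` from `Ind(A)`:
`I_A ⊨ p(as)` iff `as` is a certain answer. -/
def FORewritable (certain : ABox → List ℕ → Prop) (admissible : ABox → Prop)
    (xs : List ℕ) : Prop :=
  ∃ p : FO, p.free ⊆ {x | x ∈ xs} ∧
    ∀ A : ABox, admissible A →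
      ∀ as : List ℕ, as.length = xs.length → (∀ a ∈ as, a ∈ A.ind) →
        (A.satFO p xs as ↔ certain A as)

/-! ### Roles, basic concepts and entailment -/

theorem Role.flip_flip (ρ : Role) : ρ.flip.flip = ρ := by cases ρ <;> rfl

theorem Role.name_flip (ρ : Role) : ρ.flip.name = ρ.name := by cases ρ <;> rfl

theorem Interp.mem_rI_flip (I : Interp) (ρ : Role) (d e : I.Dom) :
    (d, e) ∈ I.rI ρ.flip ↔ (e, d) ∈ I.rI ρ := by
  cases ρ <;> exact Iff.rfl

/-- The concept or role name occurring in a basic concept. -/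
def Basic.nm : Basic → ℕ
  | .atom B => B
  | .ex ρ => ρ.name

/-- All names occurring in the axiom are smaller than `K`. -/
def LiteAx.NamesLt (K : ℕ) : LiteAx → Prop
  | .pos B₁ B₂ => B₁.nm < K ∧ B₂.nm < K
  | .npos B₁ B₂ => B₁.nm < K ∧ B₂.nm < K
  | .ri ρ σ => ρ.name < K ∧ σ.name < K

/-- Entailed concept inclusions that are trivial or only use names below `K`. -/
def EntB (T : LiteTBox) (K : ℕ) (B C : Basic) : Prop :=
  B = C ∨ (liteEntPos T B C ∧ B.nm < K ∧ C.nm < K)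

/-- Entailed role inclusions that are trivial or only use names below `K`. -/
def EntR (T : LiteTBox) (K : ℕ) (ρ σ : Role) : Prop :=
  ρ = σ ∨ (liteEntRI T ρ σ ∧ ρ.name < K ∧ σ.name < K)

section Entailment

variable {T : LiteTBox} {K : ℕ}

theorem EntB.sound {B C : Basic} (h : EntB T K B C) : liteEntPos T B C := by
  rcases h with rfl | h
  · exact fun _ _ _ hx => hx
  · exact h.1

theorem EntR.sound {ρ σ : Role} (h : EntR T K ρ σ) : liteEntRI T ρ σ := by
  rcases h with rfl | h
  · exact fun _ _ _ hx => hx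
  · exact h.1

theorem EntB.trans {B C D : Basic} (h : EntB T K B C) (h' : EntB T K C D) : EntB T K B D := by
  rcases h with rfl | ⟨h, hB, hC⟩
  · exact h'
  · rcases h' with rfl | ⟨h', -, hD⟩
    · exact .inr ⟨h, hB, hC⟩
    · exact .inr ⟨fun I hI => (h I hI).trans (h' I hI), hB, hD⟩

theorem EntR.trans {ρ σ τ : Role} (h : EntR T K ρ σ) (h' : EntR T K σ τ) : EntR T K ρ τ := by
  rcases h with rfl | ⟨h, hB, hC⟩
  · exact h'
  · rcases h' with rfl | ⟨h', -, hD⟩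
    · exact .inr ⟨h, hB, hC⟩
    · exact .inr ⟨fun I hI => (h I hI).trans (h' I hI), hB, hD⟩

theorem liteEntRI.flip {ρ σ : Role} (h : liteEntRI T ρ σ) : liteEntRI T ρ.flip σ.flip := by
  rintro I hI ⟨d, e⟩ hde
  rw [I.mem_rI_flip] at hde ⊢
  exact h I hI hde

theorem EntR.flip {ρ σ : Role} (h : EntR T K ρ σ) : EntR T K ρ.flip σ.flip := by
  rcases h with rfl | ⟨h, hB, hC⟩
  · exact .inl rfl
  · exact .inr ⟨h.flip, by rwa [Role.name_flip], by rwa [Role.name_flip]⟩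

theorem liteEntRI.ex {ρ σ : Role} (h : liteEntRI T ρ σ) : liteEntPos T (.ex ρ) (.ex σ) := by
  rintro I hI d ⟨e, he⟩
  exact ⟨e, h I hI he⟩

theorem EntR.ex {ρ σ : Role} (h : EntR T K ρ σ) : EntB T K (.ex ρ) (.ex σ) := by
  rcases h with rfl | ⟨h, hB, hC⟩
  · exact .inl rfl
  · exact .inr ⟨h.ex, hB, hC⟩

end Entailment

/-! ### The canonical interpretation -/

/-- Asserted (possibly inverse) roles. -/
def ABox.AR (A : ABox) : Role → ℕ → ℕ → Prop
  | .nm r, a, b => (r, a, b) ∈ A.ra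
  | .inv r, a, b => (r, b, a) ∈ A.ra

/-- Asserted basic concepts. -/
def ABox.AB (A : ABox) : Basic → ℕ → Prop
  | .atom B, a => (B, a) ∈ A.ca
  | .ex ρ, a => ∃ b, A.AR ρ a b

/-- Derived roles between individuals. -/
def ABox.DR (A : ABox) (T : LiteTBox) (K : ℕ) (ρ : Role) (a b : ℕ) : Prop :=
  ∃ σ, A.AR σ a b ∧ EntR T K σ ρ

/-- Derived basic concepts of individuals. -/
def ABox.DB (A : ABox) (T : LiteTBox) (K : ℕ) (C : Basic) (a : ℕ) : Prop :=
  ∃ B, A.AB B a ∧ EntB T K B C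

/-- The individual `a` requires a fresh `ρ`-successor. -/
def ABox.Gen (A : ABox) (T : LiteTBox) (K : ℕ) (ρ : Role) (a : ℕ) : Prop :=
  A.DB T K (.ex ρ) a ∧ ¬ ∃ b, A.DR T K ρ a b

/-- The word `w` (read from right to left) leads from `a` to an element of the canonical
interpretation. -/
def ABox.Path (A : ABox) (T : LiteTBox) (K : ℕ) (a : ℕ) : List Role → Prop
  | [] => True
  | [ρ] => A.Gen T K ρ a
  | σ :: ρ :: w =>
    A.Path T K a (ρ :: w) ∧ EntB T K (.ex ρ.flip) (.ex σ) ∧ ¬ EntR T K ρ.flip σ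

/-- Basic concepts in the canonical interpretation. -/
def ABox.UB (A : ABox) (T : LiteTBox) (K : ℕ) (B : Basic) (a : ℕ) : List Role → Prop
  | [] => A.DB T K B a
  | ρ :: w => A.Path T K a (ρ :: w) ∧ EntB T K (.ex ρ.flip) B

/-- Roles in the canonical interpretation. -/
def ABox.UR (A : ABox) (T : LiteTBox) (K : ℕ) (σ : Role) (a : ℕ) (w : List Role)
    (b : ℕ) (w' : List Role) : Prop :=
  ((w = [] ∧ w' = []) ∧ A.DR T K σ a b) ∨
  (a = b ∧ A.Path T K a w' ∧ ∃ ρ, w' = ρ :: w ∧ EntR T K ρ σ) ∨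
  (a = b ∧ A.Path T K a w ∧ ∃ ρ, w = ρ :: w' ∧ EntR T K ρ.flip σ)

open Classical in
/-- The canonical interpretation of a nonempty ABox. -/
noncomputable def ABox.canon (A : ABox) (T : LiteTBox) (K : ℕ) (hA : Nonempty A.ind) : Interp where
  Dom := A.ind × List Role
  dne := ⟨⟨hA.some, []⟩⟩
  ind a := if h : a ∈ A.ind then some (⟨a, h⟩, []) else none
  ind_inj a b d h h' := by
    split_ifs at h h'
    have := (Option.some.inj h).trans (Option.some.inj h').symm
    simpa using this
  cInt B := {x | A.UB T K (.atom B) x.1 x.2}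
  rInt r := {p | A.UR T K (.nm r) p.1.1 p.1.2 p.2.1 p.2.2}

section Canonical

variable {A : ABox} {T : LiteTBox} {K : ℕ}

theorem ABox.AR_flip {ρ : Role} {a b : ℕ} : A.AR ρ.flip a b ↔ A.AR ρ b a := by
  cases ρ <;> exact Iff.rfl

theorem ABox.AR.mem_left {ρ : Role} {a b : ℕ} (h : A.AR ρ a b) : a ∈ A.ind := by
  cases ρ
  · exact .inr ⟨_, h, .inl rfl⟩
  · exact .inr ⟨_, h, .inr rfl⟩

theorem ABox.AR.mem_right {ρ : Role} {a b : ℕ} (h : A.AR ρ a b) : b ∈ A.ind :=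
  (AR_flip.2 h).mem_left

theorem ABox.DR.flip {ρ : Role} {a b : ℕ} (h : A.DR T K ρ a b) : A.DR T K ρ.flip b a := by
  obtain ⟨σ, h, h'⟩ := h
  exact ⟨σ.flip, AR_flip.2 h, h'.flip⟩

theorem ABox.DR.mem_right {ρ : Role} {a b : ℕ} (h : A.DR T K ρ a b) : b ∈ A.ind :=
  h.choose_spec.1.mem_right

theorem ABox.DR.ex {ρ : Role} {a b : ℕ} (h : A.DR T K ρ a b) : A.DB T K (.ex ρ) a := by
  obtain ⟨σ, h, h'⟩ := h
  exact ⟨.ex σ, ⟨b, h⟩, h'.ex⟩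

theorem ABox.DB.mono {B C : Basic} {a : ℕ} (h : A.DB T K B a) (h' : EntB T K B C) :
    A.DB T K C a := by
  obtain ⟨D, h, h''⟩ := h
  exact ⟨D, h, h''.trans h'⟩

theorem ABox.UB.mono {B C : Basic} {a : ℕ} {w : List Role} (h : A.UB T K B a w)
    (h' : EntB T K B C) : A.UB T K C a w := by
  cases w with
  | nil => exact DB.mono h h'
  | cons ρ w => exact ⟨h.1, h.2.trans h'⟩

theorem ABox.UR.mono {ρ σ : Role} {a b : ℕ} {w w' : List Role} (h : A.UR T K ρ a w b w')
    (h' : EntR T K ρ σ) : A.UR T K σ a w b w' := by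
  rcases h with ⟨h0, τ, h1, h2⟩ | ⟨h0, h1, τ, h2, h3⟩ | ⟨h0, h1, τ, h2, h3⟩
  · exact .inl ⟨h0, τ, h1, h2.trans h'⟩
  · exact .inr (.inl ⟨h0, h1, τ, h2, h3.trans h'⟩)
  · exact .inr (.inr ⟨h0, h1, τ, h2, h3.trans h'⟩)

theorem ABox.UR.flip {σ : Role} {a b : ℕ} {w w' : List Role} (h : A.UR T K σ a w b w') :
    A.UR T K σ.flip b w' a w := by
  rcases h with ⟨⟨h0, h0'⟩, h⟩ | ⟨rfl, h1, τ, h2, h3⟩ | ⟨rfl, h1, τ, h2, h3⟩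
  · exact .inl ⟨⟨h0', h0⟩, h.flip⟩
  · exact .inr (.inr ⟨rfl, h1, τ, h2, h3.flip⟩)
  · exact .inr (.inl ⟨rfl, h1, τ, h2, by simpa [Role.flip_flip] using h3.flip⟩)

theorem ABox.UR_flip {σ : Role} {a b : ℕ} {w w' : List Role} :
    A.UR T K σ.flip b w' a w ↔ A.UR T K σ a w b w' :=
  ⟨fun h => by simpa [Role.flip_flip] using h.flip, UR.flip⟩

theorem ABox.mem_canon_rI {hA : Nonempty A.ind} {σ : Role} {x y : A.ind × List Role} :
    (x, y) ∈ (A.canon T K hA).rI σ ↔ A.UR T K σ x.1 x.2 y.1 y.2 := by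
  cases σ with
  | nm r => exact Iff.rfl
  | inv r => exact (UR_flip (σ := .nm r)).symm

theorem ABox.mem_canon_semB {hA : Nonempty A.ind} {B : Basic} {x : A.ind × List Role} :
    x ∈ (A.canon T K hA).semB B ↔ A.UB T K B x.1 x.2 := by
  cases B with
  | atom B => exact Iff.rfl
  | ex σ =>
    obtain ⟨a, w⟩ := x
    refine (exists_congr fun y => mem_canon_rI (x := (a, w)) (y := y)).trans ?_
    constructor
    · rintro ⟨⟨b, w'⟩, ⟨⟨rfl, rfl⟩, h⟩ | ⟨h0, h1, ρ, rfl, h3⟩ | ⟨h0, h1, ρ, rfl, h3⟩⟩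
      · exact DR.ex h
      · cases w with
        | nil => exact DB.mono h1.1 h3.ex
        | cons τ w => exact ⟨h1.1, h1.2.1.trans h3.ex⟩
      · exact ⟨h1, h3.ex⟩
    · intro h
      cases w with
      | nil =>
        by_cases hb : ∃ b, A.DR T K σ a b
        · obtain ⟨b, hb⟩ := hb
          exact ⟨(⟨b, hb.mem_right⟩, []), .inl ⟨⟨rfl, rfl⟩, hb⟩⟩
        · exact ⟨(a, [σ]), .inr (.inl ⟨rfl, ⟨h, hb⟩, σ, rfl, .inl rfl⟩)⟩
      | cons ρ w =>
        by_cases hp : EntR T K ρ.flip σ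
        · exact ⟨(a, w), .inr (.inr ⟨rfl, h.1, ρ, rfl, hp⟩)⟩
        · exact ⟨(a, σ :: ρ :: w), .inr (.inl ⟨rfl, ⟨h.1, h.2, hp⟩, σ, rfl, .inl rfl⟩)⟩

theorem ABox.canon_ind_eq_some {hA : Nonempty A.ind} {a : ℕ} {x : A.ind × List Role} :
    (A.canon T K hA).ind a = some x ↔ a = x.1 ∧ x.2 = [] := by
  obtain ⟨⟨b, hb⟩, w⟩ := x
  dsimp only [canon]
  split_ifs with h
  · simp [eq_comm]
  · simp only [false_iff, not_and]
    rintro rfl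
    exact absurd hb h

theorem ABox.canon_modelA {hA : Nonempty A.ind} : (A.canon T K hA).modelA A := by
  refine ⟨fun p hp => ?_, fun t ht => ?_⟩
  · refine ⟨(⟨p.2, .inl ⟨p, hp, rfl⟩⟩, []), canon_ind_eq_some.2 ⟨rfl, rfl⟩, ?_⟩
    exact ⟨.atom p.1, hp, .inl rfl⟩
  · refine ⟨(⟨t.2.1, .inr ⟨t, ht, .inl rfl⟩⟩, []), (⟨t.2.2, .inr ⟨t, ht, .inr rfl⟩⟩, []),
      canon_ind_eq_some.2 ⟨rfl, rfl⟩, canon_ind_eq_some.2 ⟨rfl, rfl⟩, ?_⟩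
    exact .inl ⟨⟨rfl, rfl⟩, .nm t.1, ht, .inl rfl⟩

theorem ABox.canon_pos {hA : Nonempty A.ind} (hT : ∀ ax ∈ T, LiteAx.NamesLt K ax) {B C : Basic}
    (h : LiteAx.pos B C ∈ T) : (A.canon T K hA).semB B ⊆ (A.canon T K hA).semB C := by
  intro x hx
  exact mem_canon_semB.2 ((mem_canon_semB.1 hx).mono (.inr ⟨fun I hI => hI.1 _ _ h, hT _ h⟩))

theorem ABox.canon_ri {hA : Nonempty A.ind} (hT : ∀ ax ∈ T, LiteAx.NamesLt K ax) {ρ σ : Role}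
    (h : LiteAx.ri ρ σ ∈ T) : (A.canon T K hA).rI ρ ⊆ (A.canon T K hA).rI σ := by
  rintro ⟨x, y⟩ hx
  exact mem_canon_rI.2 ((mem_canon_rI.1 hx).mono (.inr ⟨fun I hI => hI.2.2 _ _ h, hT _ h⟩))

end Canonical

/-! ### Universality of the canonical interpretation -/

/-- Homomorphisms of interpretations. -/
def IsHom (I J : Interp) (h : I.Dom → J.Dom) : Prop :=
  (∀ B d, d ∈ I.cInt B → h d ∈ J.cInt B) ∧ (∀ r d e, (d, e) ∈ I.rInt r → (h d, h e) ∈ J.rInt r)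

theorem IsHom.rI {I J : Interp} {h : I.Dom → J.Dom} (hh : IsHom I J h) {ρ : Role} {d e : I.Dom}
    (hde : (d, e) ∈ I.rI ρ) : (h d, h e) ∈ J.rI ρ := by
  cases ρ with
  | nm r => exact hh.2 r d e hde
  | inv r => exact hh.2 r e d hde

theorem IsHom.semB {I J : Interp} {h : I.Dom → J.Dom} (hh : IsHom I J h) {B : Basic} {d : I.Dom}
    (hd : d ∈ I.semB B) : h d ∈ J.semB B := by
  cases B with
  | atom B => exact hh.1 B d hd
  | ex ρ =>
    obtain ⟨e, he⟩ := hd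
    exact ⟨h e, hh.rI he⟩

section Homs

variable {I J : Interp} {h : I.Dom → J.Dom} {q : FO}

theorem IsHom.evalFO_conjAtoms (hh : IsHom I J h) (hq : IsConjAtoms q) (v : ℕ → I.Dom)
    (hv : I.evalFO v q) : J.evalFO (h ∘ v) q := by
  induction hq with
  | capp B x => exact hh.1 B _ hv
  | rapp r x y => exact hh.2 r _ _ hv
  | conj _ _ ih₁ ih₂ => exact ⟨ih₁ hv.1, ih₂ hv.2⟩

theorem IsHom.evalFO_cq (hh : IsHom I J h) (hq : IsCQ q) (v : ℕ → I.Dom)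
    (hv : I.evalFO v q) : J.evalFO (h ∘ v) q := by
  induction hq generalizing v with
  | base hq => exact hh.evalFO_conjAtoms hq v hv
  | ex x _ ih =>
    obtain ⟨d, hd⟩ := hv
    refine ⟨h d, ?_⟩
    rw [← Function.comp_update]
    exact ih _ hd

theorem IsHom.evalFO_ucq (hh : IsHom I J h) (hq : IsUCQ q) (v : ℕ → I.Dom)
    (hv : I.evalFO v q) : J.evalFO (h ∘ v) q := by
  induction hq with
  | base hq => exact hh.evalFO_cq hq v hv
  | disj _ _ ih₁ ih₂ => exact hv.imp ih₁ ih₂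

end Homs

open Classical in
/-- The image of a word in an interpretation, following role successors from `d`. -/
noncomputable def Interp.walk (J : Interp) (d : J.Dom) : List Role → J.Dom
  | [] => d
  | ρ :: w => if h : ∃ e, (J.walk d w, e) ∈ J.rI ρ then h.choose else d

section Universal

variable {A : ABox} {T : LiteTBox} {K : ℕ} {J : Interp}

theorem Interp.modelA.AR (hJ : J.modelA A) {ρ : Role} {a b : ℕ} (h : A.AR ρ a b) :
    ∃ d e, J.ind a = some d ∧ J.ind b = some e ∧ (d, e) ∈ J.rI ρ := by
  cases ρ with
  | nm r => exact hJ.2 _ h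
  | inv r =>
    obtain ⟨d, e, h₁, h₂, h₃⟩ := hJ.2 _ h
    exact ⟨e, d, h₂, h₁, h₃⟩

theorem Interp.modelA.AB (hJ : J.modelA A) {B : Basic} {a : ℕ} {d : J.Dom}
    (hd : J.ind a = some d) (h : A.AB B a) : d ∈ J.semB B := by
  cases B with
  | atom B =>
    obtain ⟨e, he, h⟩ := hJ.1 _ h
    obtain rfl : d = e := Option.some.inj (hd.symm.trans he)
    exact h
  | ex ρ =>
    obtain ⟨b, h⟩ := h
    obtain ⟨d', e, h₁, h₂, h₃⟩ := hJ.AR h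
    obtain rfl : d = d' := Option.some.inj (hd.symm.trans h₁)
    exact ⟨e, h₃⟩

theorem Interp.modelA.DB (hJ : J.modelA A) (hT : J.modelLite T) {B : Basic} {a : ℕ} {d : J.Dom}
    (hd : J.ind a = some d) (h : A.DB T K B a) : d ∈ J.semB B := by
  obtain ⟨C, h, h'⟩ := h
  exact h'.sound J hT (hJ.AB hd h)

theorem Interp.modelA.exists_ind (hJ : J.modelA A) {a : ℕ} (ha : a ∈ A.ind) :
    ∃ d, J.ind a = some d := by
  rcases ha with ⟨p, hp, rfl⟩ | ⟨t, ht, rfl | rfl⟩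
  · exact (hJ.1 p hp).imp fun d hd => hd.1
  · obtain ⟨d, e, h, -⟩ := hJ.2 t ht
    exact ⟨d, h⟩
  · obtain ⟨d, e, -, h, -⟩ := hJ.2 t ht
    exact ⟨e, h⟩

theorem Interp.modelA.walk (hJ : J.modelA A) (hT : J.modelLite T) {a : ℕ} {d : J.Dom}
    (hd : J.ind a = some d) (ρ : Role) (w : List Role) (h : A.Path T K a (ρ :: w)) :
    (J.walk d w, J.walk d (ρ :: w)) ∈ J.rI ρ := by
  have key : ∃ e, (J.walk d w, e) ∈ J.rI ρ := by
    induction w generalizing ρ with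
    | nil => exact hJ.DB hT hd h.1
    | cons σ w ih =>
      have h₁ : ∃ e, (J.walk d w, e) ∈ J.rI σ := ih σ h.1
      have h₂ : (J.walk d w, J.walk d (σ :: w)) ∈ J.rI σ := by
        rw [Interp.walk, dif_pos h₁]
        exact h₁.choose_spec
      exact h.2.1.sound J hT ⟨_, (J.mem_rI_flip σ _ _).2 h₂⟩
  rw [Interp.walk, dif_pos key]
  exact key.choose_spec

theorem ABox.exists_hom_canon {hA : Nonempty A.ind} (hJ : J.modelA A) (hT : J.modelLite T) :
    ∃ h : A.ind × List Role → J.Dom, IsHom (A.canon T K hA) J h ∧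
      ∀ a : A.ind, J.ind a = some (h (a, [])) := by
  choose f hf using fun a : A.ind => hJ.exists_ind a.2
  refine ⟨fun x => J.walk (f x.1) x.2, ⟨?_, ?_⟩, hf⟩
  · rintro B ⟨a, w⟩ hx
    change A.UB T K (.atom B) a w at hx
    cases w with
    | nil => exact hJ.DB hT (hf a) hx
    | cons ρ w =>
      exact hx.2.sound J hT ⟨_, (J.mem_rI_flip _ _ _).2 (hJ.walk hT (hf a) ρ w hx.1)⟩
  · rintro r ⟨a, w⟩ ⟨b, w'⟩ hx
    change A.UR T K (.nm r) a w b w' at hx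
    rcases hx with ⟨⟨rfl, rfl⟩, σ, h₁, h₂⟩ | ⟨h₀, h₁, ρ, rfl, h₃⟩ | ⟨h₀, h₁, ρ, rfl, h₃⟩
    · obtain ⟨d, e, hd, he, h⟩ := hJ.AR h₁
      obtain rfl := Option.some.inj ((hf a).symm.trans hd)
      obtain rfl := Option.some.inj ((hf b).symm.trans he)
      exact h₂.sound J hT h
    · obtain rfl := Subtype.ext h₀
      exact h₃.sound J hT (hJ.walk hT (hf a) ρ w h₁)
    · obtain rfl := Subtype.ext h₀
      exact h₃.sound J hT ((J.mem_rI_flip _ _ _).2 (hJ.walk hT (hf a) ρ w' h₁))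

end Universal

/-! ### Safe TBoxes -/

section Safe

variable {A : ABox} {T : LiteTBox} {K : ℕ} {J : Interp} {Sc Sr : Set ℕ}

theorem Interp.respects.exists_AR (hR : J.respects A Sc Sr) {ρ : Role} (hρ : ρ.name ∈ Sr) {a : ℕ}
    {d e : J.Dom} (hd : J.ind a = some d) (h : (d, e) ∈ J.rI ρ) :
    ∃ b, J.ind b = some e ∧ A.AR ρ a b := by
  cases ρ with
  | nm r =>
    obtain ⟨a', b, h₁, h₂, h₃⟩ := (hR.2 r hρ d e).1 h
    obtain rfl := J.ind_inj _ _ _ hd h₁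
    exact ⟨b, h₂, h₃⟩
  | inv r =>
    obtain ⟨b, a', h₁, h₂, h₃⟩ := (hR.2 r hρ e d).1 h
    obtain rfl := J.ind_inj _ _ _ hd h₂
    exact ⟨b, h₁, h₃⟩

theorem ABox.Path.not_closed (hsafe : LiteSafe T Sc Sr) (hSr : ∀ r ∈ Sr, r < K)
    (hJ : J.modelA A) (hT : J.modelLite T) (hR : J.respects A Sc Sr) {a : ℕ} (ha : a ∈ A.ind)
    (w : List Role) (ρ : Role) (h : A.Path T K a (ρ :: w)) (B : Basic) (hBc : B.sigC ⊆ Sc)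
    (hBr : B.sigR ⊆ Sr) : ¬ liteEntPos T (.ex ρ.flip) B := by
  intro hB
  obtain ⟨d, hd⟩ := hJ.exists_ind ha
  induction w generalizing ρ B with
  | nil =>
    obtain ⟨⟨C, hC, hCρ⟩, hno⟩ := h
    refine hsafe ⟨C, B, ρ, ⟨J, hT, d, hJ.AB hd hC⟩, hCρ.sound, hB, ?_, ⟨hBc, hBr⟩, ?_⟩
    · rintro σ hσ rfl
      obtain ⟨b, hb⟩ := hC
      refine hno ⟨b, σ, hb, ?_⟩
      rcases hCρ with h | h
      · exact .inl (Basic.ex.inj h)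
      · exact .inr ⟨hσ, h.2⟩
    · intro σ hCσ hσ hclosed
      obtain ⟨e, he⟩ := hCσ J hT (hJ.AB hd hC)
      obtain ⟨b, -, hb⟩ := hR.exists_AR hclosed hd he
      rcases hCρ with rfl | h
      · obtain ⟨b, hb⟩ := hC
        exact hno ⟨b, ρ, hb, .inl rfl⟩
      · exact hno ⟨b, σ, hb, .inr ⟨hσ, hSr _ hclosed, h.2.2⟩⟩
  | cons τ w ih =>
    obtain ⟨h₁, h₂, h₃⟩ := h
    refine hsafe ⟨.ex τ.flip, B, ρ, ⟨J, hT, J.walk d (τ :: w), _,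
      (J.mem_rI_flip _ _ _).2 (hJ.walk hT hd τ w h₁)⟩, h₂.sound, hB, ?_, ⟨hBc, hBr⟩, ?_⟩
    · intro σ hσ heq
      obtain rfl := Basic.ex.inj heq
      rcases h₂ with h | h
      · exact h₃ (.inl (Basic.ex.inj h))
      · exact h₃ (.inr ⟨hσ, h.2⟩)
    · intro σ hσ _ hclosed
      exact ih τ h₁ (.ex σ) (Set.empty_subset _) (by simpa [Basic.sigR] using hclosed) hσ

theorem ABox.canon_modelLite {hA : Nonempty A.ind} (hK : ∀ ax ∈ T, LiteAx.NamesLt K ax)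
    (hJ : J.modelA A) (hT : J.modelLite T) : (A.canon T K hA).modelLite T := by
  refine ⟨fun B C h => canon_pos hK h, fun B C h => ?_, fun ρ σ h => canon_ri hK h⟩
  obtain ⟨f, hf, -⟩ := exists_hom_canon (hA := hA) (K := K) hJ hT
  rw [Set.eq_empty_iff_forall_notMem]
  rintro x ⟨hB, hC⟩
  have : f x ∈ J.semB B ∩ J.semB C := ⟨hf.semB hB, hf.semB hC⟩
  rw [hT.2.1 B C h] at this
  exact this

theorem ABox.canon_respects {hA : Nonempty A.ind} (hsafe : LiteSafe T Sc Sr)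
    (hSr : ∀ r ∈ Sr, r < K) (hJ : J.modelA A) (hT : J.modelLite T) (hR : J.respects A Sc Sr) :
    (A.canon T K hA).respects A Sc Sr := by
  obtain ⟨f, hf, hfi⟩ := exists_hom_canon (hA := hA) (K := K) hJ hT
  have hno := fun a : A.ind => Path.not_closed hsafe hSr hJ hT hR a.2
  refine ⟨?_, ?_⟩
  · rintro B hB ⟨a, w⟩
    constructor
    · intro h
      cases w with
      | nil =>
        obtain ⟨a', h₁, h₂⟩ := (hR.1 B hB _).1 (hf.1 B _ h)
        obtain rfl := J.ind_inj _ _ _ (hfi a) h₁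
        exact ⟨a, canon_ind_eq_some.2 ⟨rfl, rfl⟩, h₂⟩
      | cons ρ w =>
        exact absurd h.2.sound
          (hno a w ρ h.1 (.atom B) (by simpa [Basic.sigC] using hB) (Set.empty_subset _))
    · rintro ⟨a', h₁, h₂⟩
      obtain ⟨d, hd, h⟩ := (canon_modelA (hA := hA) (T := T) (K := K)).1 _ h₂
      obtain rfl := Option.some.inj (h₁.symm.trans hd)
      exact h
  · rintro r hr ⟨a, w⟩ ⟨b, w'⟩
    constructor
    · intro h
      have h' := hf.2 r _ _ h
      rcases h with ⟨⟨h₀, h₁⟩, -⟩ | ⟨-, h₁, ρ, h₂, h₃⟩ | ⟨-, h₁, ρ, h₂, h₃⟩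
      · dsimp only at h₀ h₁
        subst h₀ h₁
        obtain ⟨a', b', h₁, h₂, h₃⟩ := (hR.2 r hr _ _).1 h'
        obtain rfl := J.ind_inj _ _ _ (hfi a) h₁
        obtain rfl := J.ind_inj _ _ _ (hfi b) h₂
        exact ⟨a, b, canon_ind_eq_some.2 ⟨rfl, rfl⟩, canon_ind_eq_some.2 ⟨rfl, rfl⟩, h₃⟩
      · dsimp only at h₁ h₂
        subst h₂
        exact absurd h₃.flip.ex.sound
          (hno a w ρ h₁ _ (Set.empty_subset _)
            (by simpa [Basic.sigR, Role.flip, Role.name] using hr))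
      · dsimp only at h₁ h₂
        subst h₂
        exact absurd h₃.ex.sound
          (hno a w' ρ h₁ _ (Set.empty_subset _) (by simpa [Basic.sigR, Role.name] using hr))
    · rintro ⟨a', b', h₁, h₂, h₃⟩
      obtain ⟨d, e, hd, he, h⟩ := (canon_modelA (hA := hA) (T := T) (K := K)).2 _ h₃
      obtain rfl := Option.some.inj (h₁.symm.trans hd)
      obtain rfl := Option.some.inj (h₂.symm.trans he)
      exact h

theorem ABox.certAns_iff_canon {hA : Nonempty A.ind} (hsafe : LiteSafe T Sc Sr)
    (hK : ∀ ax ∈ T, LiteAx.NamesLt K ax) (hSr : ∀ r ∈ Sr, r < K) {q : FO} (hq : IsUCQ q)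
    (xs as : List ℕ) :
    certAns (fun I => I.modelLite T) Sc Sr A q xs as ↔
      ((A.canon T K hA).modelLite T ∧ (A.canon T K hA).respects A Sc Sr →
        (A.canon T K hA).sat q xs as) := by
  refine ⟨fun h hg => h _ hg.1 canon_modelA hg.2, fun h J hT hJ hR => ?_⟩
  obtain ⟨f, hf, hfi⟩ := exists_hom_canon (hA := hA) (K := K) hJ hT
  obtain ⟨v, hv, hvq⟩ := h ⟨canon_modelLite hK hJ hT, canon_respects hsafe hSr hJ hT hR⟩
  refine ⟨f ∘ v, fun p hp => ?_, hf.evalFO_ucq hq v hvq⟩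
  obtain ⟨h₁, h₂⟩ := canon_ind_eq_some.1 (hv p hp)
  rw [h₁, hfi]
  exact congrArg (fun w => some (f ((v p.1).1, w))) h₂.symm

end Safe

/-! ### First-order definability over the active domain -/

theorem ABox.evalFO_congr (A : ABox) (p : FO) {v v' : ℕ → ℕ} (h : ∀ x ∈ p.free, v x = v' x) :
    A.evalFO v p ↔ A.evalFO v' p := by
  induction p generalizing v v' with
  | eq x y => simp only [evalFO, h x (.inl rfl), h y (.inr rfl)]
  | capp B x => simp only [evalFO, h x rfl]
  | rapp r x y => simp only [evalFO, h x (.inl rfl), h y (.inr rfl)]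
  | neg φ ih => exact not_congr (ih h)
  | conj φ ψ ih₁ ih₂ =>
    exact and_congr (ih₁ fun x hx => h x (.inl hx)) (ih₂ fun x hx => h x (.inr hx))
  | disj φ ψ ih₁ ih₂ =>
    exact or_congr (ih₁ fun x hx => h x (.inl hx)) (ih₂ fun x hx => h x (.inr hx))
  | ex y φ ih =>
    refine exists_congr fun a => and_congr_right fun _ => ih fun x hx => ?_
    by_cases hxy : x = y
    · subst hxy; simp
    · simp only [Function.update_of_ne hxy]
      exact h x ⟨hx, hxy⟩

/-- Properties of assignments of variables to individuals of ABoxes. -/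
abbrev Property := (A : ABox) → (ℕ → A.ind) → Prop

/-- The property is definable by a first-order formula with free variables in `V`. -/
def FODef (V : Set ℕ) (P : Property) : Prop :=
  ∃ p : FO, p.free ⊆ V ∧ ∀ A v, A.evalFO (fun x => (v x : ℕ)) p ↔ P A v

namespace FODef

variable {V V' : Set ℕ} {P Q : Property}

theorem mono (h : FODef V P) (hV : V ⊆ V') : FODef V' P :=
  h.imp fun _ hp => ⟨hp.1.trans hV, hp.2⟩

theorem congr (h : FODef V P) (hPQ : ∀ A v, P A v ↔ Q A v) : FODef V Q :=
  h.imp fun _ hp => ⟨hp.1, fun A v => (hp.2 A v).trans (hPQ A v)⟩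

theorem not (h : FODef V P) : FODef V fun A v => ¬ P A v := by
  obtain ⟨p, hp, h⟩ := h
  exact ⟨.neg p, hp, fun A v => not_congr (h A v)⟩

theorem and (h : FODef V P) (h' : FODef V Q) : FODef V fun A v => P A v ∧ Q A v := by
  obtain ⟨p, hp, h⟩ := h
  obtain ⟨p', hp', h'⟩ := h'
  exact ⟨.conj p p', Set.union_subset hp hp', fun A v => and_congr (h A v) (h' A v)⟩

theorem or (h : FODef V P) (h' : FODef V Q) : FODef V fun A v => P A v ∨ Q A v := by
  obtain ⟨p, hp, h⟩ := h
  obtain ⟨p', hp', h'⟩ := h'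
  exact ⟨.disj p p', Set.union_subset hp hp', fun A v => or_congr (h A v) (h' A v)⟩

theorem const (c : Prop) : FODef V fun _ _ => c := by
  have htrue : FODef V fun _ _ => True :=
    ⟨.ex 0 (.eq 0 0), by simp [FO.free], fun A v => iff_true_intro ⟨v 0, (v 0).2, rfl⟩⟩
  by_cases hc : c
  · exact htrue.congr fun _ _ => by simp [hc]
  · exact htrue.not.congr fun _ _ => by simp [hc]

theorem ex (x : ℕ) (h : FODef V P) :
    FODef (V \ {x}) fun A v => ∃ a : A.ind, P A (Function.update v x a) := by
  obtain ⟨p, hp, h⟩ := h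
  refine ⟨.ex x p, Set.sdiff_subset_sdiff_left hp, fun A v => ?_⟩
  simp only [ABox.evalFO, ← h, Subtype.exists, ← exists_prop]
  refine exists_congr fun a => exists_congr fun ha => iff_of_eq ?_
  congr 1
  funext y
  by_cases hy : y = x
  · subst hy; simp
  · simp [Function.update_of_ne hy]

theorem exists_mem {ι : Type} (s : Finset ι) {P : ι → Property} (h : ∀ i, FODef V (P i)) :
    FODef V fun A v => ∃ i ∈ s, P i A v := by
  classical
  induction s using Finset.induction_on with
  | empty => exact (const False).congr fun _ _ => by simp
  | insert i s _ ih => exact ((h i).or ih).congr fun _ _ => by simp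

theorem exists_finite {ι : Type} [Finite ι] {P : ι → Property} (h : ∀ i, FODef V (P i)) :
    FODef V fun A v => ∃ i, P i A v := by
  cases nonempty_fintype ι
  exact (exists_mem Finset.univ h).congr fun _ _ => by simp

theorem forall_finite {ι : Type} [Finite ι] {P : ι → Property} (h : ∀ i, FODef V (P i)) :
    FODef V fun A v => ∀ i, P i A v :=
  (exists_finite fun i => (h i).not).not.congr fun _ _ => by simp

theorem iff (h : FODef V P) (h' : FODef V Q) : FODef V fun A v => (P A v ↔ Q A v) :=
  ((h.and h').or (h.not.and h'.not)).congr fun _ _ => by tauto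

theorem eq (x y : ℕ) : FODef {x, y} fun _ v => (v x : ℕ) = v y :=
  ⟨.eq x y, subset_rfl, fun _ _ => Iff.rfl⟩

theorem AR (ρ : Role) (x y : ℕ) : FODef {x, y} fun A v => A.AR ρ (v x) (v y) := by
  cases ρ with
  | nm r => exact ⟨.rapp r x y, subset_rfl, fun _ _ => Iff.rfl⟩
  | inv r => exact ⟨.rapp r y x, (Set.pair_comm y x).subset, fun _ _ => Iff.rfl⟩

theorem exists_right {P : (A : ABox) → A.ind → A.ind → Prop} {x : ℕ}
    (h : FODef {x, x + 1} fun A v => P A (v x) (v (x + 1))) :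
    FODef {x} fun A v => ∃ b, P A (v x) b := by
  refine ((h.ex (x + 1)).mono ?_).congr fun A v => ?_
  · rintro y ⟨rfl | hy, hy'⟩
    · rfl
    · exact absurd hy hy'
  · simp

theorem AB (B : Basic) (x : ℕ) : FODef {x} fun A v => A.AB B (v x) := by
  cases B with
  | atom B => exact ⟨.capp B x, subset_rfl, fun _ _ => Iff.rfl⟩
  | ex ρ =>
    refine (exists_right (P := fun A a b => A.AR ρ a b) (AR ρ x (x + 1))).congr fun A v => ?_
    exact ⟨fun ⟨b, hb⟩ => ⟨b, hb⟩, fun ⟨b, hb⟩ => ⟨⟨b, hb.mem_right⟩, hb⟩⟩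

end FODef

instance finite_role_lt (K : ℕ) : Finite {ρ : Role // ρ.name < K} := by
  have : ((Role.nm '' Set.Iio K) ∪ (Role.inv '' Set.Iio K)).Finite :=
    ((Set.finite_Iio K).image _).union ((Set.finite_Iio K).image _)
  refine (this.subset (t := {ρ : Role | ρ.name < K}) ?_).to_subtype
  rintro (r | r) h
  · exact .inl ⟨r, h, rfl⟩
  · exact .inr ⟨r, h, rfl⟩

instance finite_basic_lt (K : ℕ) : Finite {B : Basic // B.nm < K} := by
  have : ((Basic.atom '' Set.Iio K) ∪ (Basic.ex '' {ρ | ρ.name < K})).Finite :=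
    ((Set.finite_Iio K).image _).union
      ((Set.finite_coe_iff (s := {ρ : Role | ρ.name < K}).1 (finite_role_lt K)).image _)
  refine (this.subset (t := {B : Basic | B.nm < K}) ?_).to_subtype
  rintro (B | ρ) h
  · exact .inl ⟨B, h, rfl⟩
  · exact .inr ⟨ρ, h, rfl⟩

namespace FODef

variable (T : LiteTBox) (K : ℕ)

theorem DR (ρ : Role) (x y : ℕ) : FODef {x, y} fun A v => A.DR T K ρ (v x) (v y) := by
  refine ((AR ρ x y).or (exists_finite fun σ : {σ : Role // σ.name < K} =>
    (AR σ.1 x y).and (const (EntR T K σ ρ)))).congr fun A v => ⟨?_, ?_⟩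
  · rintro (h | ⟨σ, h⟩)
    · exact ⟨ρ, h, .inl rfl⟩
    · exact ⟨σ, h⟩
  · rintro ⟨σ, h, rfl | h'⟩
    · exact .inl h
    · exact .inr ⟨⟨σ, h'.2.1⟩, h, .inr h'⟩

theorem DB (B : Basic) (x : ℕ) : FODef {x} fun A v => A.DB T K B (v x) := by
  refine ((AB B x).or (exists_finite fun C : {C : Basic // C.nm < K} =>
    (AB C.1 x).and (const (EntB T K C B)))).congr fun A v => ⟨?_, ?_⟩
  · rintro (h | ⟨C, h⟩)
    · exact ⟨B, h, .inl rfl⟩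
    · exact ⟨C, h⟩
  · rintro ⟨C, h, rfl | h'⟩
    · exact .inl h
    · exact .inr ⟨⟨C, h'.2.1⟩, h, .inr h'⟩

theorem Gen (ρ : Role) (x : ℕ) : FODef {x} fun A v => A.Gen T K ρ (v x) := by
  refine ((DB T K (.ex ρ) x).and (exists_right (P := fun A a b => A.DR T K ρ a b)
    (DR T K ρ x (x + 1))).not).congr fun A v => and_congr_right fun _ => not_congr ?_
  exact ⟨fun ⟨b, hb⟩ => ⟨b, hb⟩, fun ⟨b, hb⟩ => ⟨⟨b, hb.mem_right⟩, hb⟩⟩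

end FODef

/-- The family of properties is uniformly determined by finitely many properties that are
definable with free variables in `V`. -/
def FinBased (V : Set ℕ) {κ : Type} (P : κ → Property) : Prop :=
  ∃ (ι : Type) (_ : Finite ι) (Φ : ι → Property), (∀ i, FODef V (Φ i)) ∧
    ∀ A v A' v', (∀ i, Φ i A v ↔ Φ i A' v') → ∀ k, P k A v ↔ P k A' v'

namespace FinBased

variable {V V' : Set ℕ} {κ : Type} {P Q : κ → Property}

theorem mono (h : FinBased V P) (hV : V ⊆ V') : FinBased V' P := by
  obtain ⟨ι, hι, Φ, hΦ, h⟩ := h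
  exact ⟨ι, hι, Φ, fun i => (hΦ i).mono hV, h⟩

theorem congr (h : FinBased V P) (hPQ : ∀ k A v, P k A v ↔ Q k A v) : FinBased V Q := by
  obtain ⟨ι, hι, Φ, hΦ, h⟩ := h
  exact ⟨ι, hι, Φ, hΦ, fun A v A' v' hi k => by rw [← hPQ, ← hPQ]; exact h A v A' v' hi k⟩

theorem const (c : κ → Prop) : FinBased V fun k _ _ => c k :=
  ⟨Empty, inferInstance, nofun, nofun, fun _ _ _ _ _ _ => Iff.rfl⟩

theorem of_foDef {P : Property} (h : FODef V P) : FinBased V fun _ : κ => P :=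
  ⟨Unit, inferInstance, fun _ => P, fun _ => h, fun _ _ _ _ hi _ => hi ()⟩

theorem not (h : FinBased V P) : FinBased V fun k A v => ¬ P k A v := by
  obtain ⟨ι, hι, Φ, hΦ, h⟩ := h
  exact ⟨ι, hι, Φ, hΦ, fun A v A' v' hi k => not_congr (h A v A' v' hi k)⟩

theorem and (h : FinBased V P) (h' : FinBased V Q) : FinBased V fun k A v => P k A v ∧ Q k A v := by
  obtain ⟨ι, hι, Φ, hΦ, h⟩ := h
  obtain ⟨ι', hι', Φ', hΦ', h'⟩ := h'
  refine ⟨ι ⊕ ι', inferInstance, Sum.elim Φ Φ', Sum.rec hΦ hΦ', fun A v A' v' hi k => ?_⟩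
  exact and_congr (h A v A' v' (fun i => hi (.inl i)) k) (h' A v A' v' (fun i => hi (.inr i)) k)

theorem or (h : FinBased V P) (h' : FinBased V Q) : FinBased V fun k A v => P k A v ∨ Q k A v :=
  (h.not.and h'.not).not.congr fun _ _ _ => by tauto

theorem iff (h : FinBased V P) (h' : FinBased V Q) :
    FinBased V fun k A v => (P k A v ↔ Q k A v) :=
  ((h.and h').or (h.not.and h'.not)).congr fun _ _ _ => by tauto

theorem foDef_exists (h : FinBased V P) : FODef V fun A v => ∃ k, P k A v := by
  obtain ⟨ι, hι, Φ, hΦ, h⟩ := h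
  refine (FODef.exists_finite fun S : Set ι =>
    (FODef.const (∃ A v, (∃ k, P k A v) ∧ ∀ i, Φ i A v ↔ i ∈ S)).and
      (FODef.forall_finite fun i => (hΦ i).iff (FODef.const (i ∈ S)))).congr fun A v => ⟨?_, ?_⟩
  · rintro ⟨S, ⟨A', v', ⟨k, hk⟩, h₁⟩, h₂⟩
    exact ⟨k, (h A v A' v' (fun i => (h₂ i).trans (h₁ i).symm) k).2 hk⟩
  · rintro ⟨k, hk⟩
    exact ⟨{i | Φ i A v}, ⟨A, v, ⟨k, hk⟩, fun _ => Iff.rfl⟩, fun _ => Iff.rfl⟩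

variable (T : LiteTBox) (K : ℕ)

theorem path (f : κ → List Role) (x : ℕ) : FinBased {x} fun k A v => A.Path T K (v x) (f k) := by
  refine ⟨{ρ : Role // ρ.name < K}, inferInstance, fun ρ A v => A.Gen T K ρ (v x),
    fun ρ => FODef.Gen T K ρ x, fun A v A' v' hi k => ?_⟩
  have hlt : ∀ {A : ABox} {ρ : Role} {a : ℕ}, A.Gen T K ρ a → ρ.name < K := by
    rintro A ρ a ⟨⟨B, hB, rfl | h⟩, hno⟩
    · obtain ⟨b, hb⟩ := hB
      exact absurd ⟨b, ρ, hb, .inl rfl⟩ hno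
    · exact h.2.2
  change A.Path T K (v x) (f k) ↔ A'.Path T K (v' x) (f k)
  generalize f k = w
  induction w with
  | nil => exact Iff.rfl
  | cons ρ w ih =>
    cases w with
    | nil => exact ⟨fun h => (hi ⟨ρ, hlt h⟩).1 h, fun h => (hi ⟨ρ, hlt h⟩).2 h⟩
    | cons σ w => exact and_congr_left fun _ => ih

theorem UB (f : κ → List Role) (B : Basic) (x : ℕ) :
    FinBased {x} fun k A v => A.UB T K B (v x) (f k) := by
  refine (((const fun k => f k = []).and (of_foDef (FODef.DB T K B x))).or
    ((path T K f x).and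
      (const fun k => ∃ ρ w, f k = ρ :: w ∧ EntB T K (.ex ρ.flip) B))).congr fun k A v => ?_
  cases f k with
  | nil => simp [ABox.UB]
  | cons ρ w => simp [ABox.UB]

theorem UR (f g : κ → List Role) (σ : Role) (x y : ℕ) :
    FinBased {x, y} fun k A v => A.UR T K σ (v x) (f k) (v y) (g k) :=
  have hx : ({x} : Set ℕ) ⊆ {x, y} := by simp
  have hy : ({y} : Set ℕ) ⊆ {x, y} := by simp
  ((const fun k => f k = [] ∧ g k = []).and (of_foDef (FODef.DR T K σ x y))).or
    (((of_foDef (FODef.eq x y)).and (((path T K g y).mono hy).and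
      (const fun k => ∃ ρ, g k = ρ :: f k ∧ EntR T K ρ σ))).congr (fun k A v => by
        refine and_congr_right fun h => ?_
        rw [h]) |>.or
    ((of_foDef (FODef.eq x y)).and (((path T K f x).mono hx).and
      (const fun k => ∃ ρ, f k = ρ :: g k ∧ EntR T K ρ.flip σ))))

end FinBased

/-! ### Queries and consistency over the canonical interpretation -/

section Definability

variable (T : LiteTBox) (K : ℕ)

theorem FinBased.conjAtoms {q : FO} (hq : IsConjAtoms q) :
    FinBased q.free fun (w : ℕ → List Role) A v =>
      (A.canon T K ⟨v 0⟩).evalFO (fun x => (v x, w x)) q := by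
  induction hq with
  | capp B x => exact FinBased.UB T K (fun w : ℕ → List Role => w x) (.atom B) x
  | rapp r x y =>
    exact FinBased.UR T K (fun w : ℕ → List Role => w x) (fun w => w y) (.nm r) x y
  | conj _ _ ih₁ ih₂ =>
    exact (ih₁.mono Set.subset_union_left).and (ih₂.mono Set.subset_union_right)

theorem FODef.cq {q : FO} (hq : IsCQ q) (W : Set (ℕ → List Role)) :
    FODef q.free fun A v =>
      ∃ w, w ∈ W ∧ (A.canon T K ⟨v 0⟩).evalFO (fun x => (v x, w x)) q := by
  induction hq generalizing W with
  | base hq => exact ((FinBased.const (· ∈ W)).and (FinBased.conjAtoms T K hq)).foDef_exists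
  | @ex φ x _ ih =>
    refine ((ih {w' | ∃ w ∈ W, ∃ u, w' = Function.update w x u}).ex x).congr fun A v => ?_
    have key : ∀ (w : ℕ → List Role) (a : A.ind) (u : List Role),
        (fun y => (Function.update v x a y, Function.update w x u y)) =
          Function.update (fun y => (v y, w y)) x (a, u) := by
      intro w a u
      funext y
      by_cases hy : y = x
      · subst hy; simp
      · simp [Function.update_of_ne hy]
    constructor
    · rintro ⟨a, _, ⟨w, hw, u, rfl⟩, h⟩
      rw [key] at h
      exact ⟨w, hw, (a, u), h⟩
    · rintro ⟨w, hw, ⟨a, u⟩, h⟩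
      refine ⟨a, _, ⟨w, hw, u, rfl⟩, ?_⟩
      rw [key]
      exact h

theorem FODef.ucq {q : FO} (hq : IsUCQ q) (W : Set (ℕ → List Role)) :
    FODef q.free fun A v =>
      ∃ w, w ∈ W ∧ (A.canon T K ⟨v 0⟩).evalFO (fun x => (v x, w x)) q := by
  induction hq with
  | base hq => exact FODef.cq T K hq W
  | disj _ _ ih₁ ih₂ =>
    refine ((ih₁.mono Set.subset_union_left).or (ih₂.mono Set.subset_union_right)).congr
      fun A v => ?_
    rw [← exists_or]
    exact exists_congr fun w => and_or_left.symm

theorem FODef.exists_ind {P : (A : ABox) → A.ind → Prop} (h : FODef {0} fun A v => P A (v 0)) :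
    FODef ∅ fun A _ => ∃ a, P A a :=
  ((h.ex 0).mono (by simp)).congr fun A v => by simp

theorem FODef.exists_ind₂ {P : (A : ABox) → A.ind → A.ind → Prop}
    (h : FODef {0, 1} fun A v => P A (v 0) (v 1)) : FODef ∅ fun A _ => ∃ a b, P A a b :=
  (((h.ex 1).ex 0).mono (by rintro x ⟨⟨rfl | hx, h₁⟩, h₀⟩; exacts [h₀ rfl, h₁ hx])).congr
    fun A v => by simp

theorem ABox.canon_modelLite_iff {A : ABox} {hA : Nonempty A.ind}
    (hK : ∀ ax ∈ T, LiteAx.NamesLt K ax) :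
    (A.canon T K hA).modelLite T ↔
      ∀ p : {p : Basic × Basic // LiteAx.npos p.1 p.2 ∈ T},
        ¬ ∃ a : A.ind, ∃ w, A.UB T K p.1.1 a w ∧ A.UB T K p.1.2 a w := by
  constructor
  · rintro ⟨-, h, -⟩ ⟨⟨B, C⟩, hp⟩ ⟨a, w, hB, hC⟩
    have : (a, w) ∈ (A.canon T K hA).semB B ∩ (A.canon T K hA).semB C :=
      ⟨mem_canon_semB.2 hB, mem_canon_semB.2 hC⟩
    rw [h B C hp] at this
    exact this
  · refine fun h => ⟨fun B C => canon_pos hK, fun B C hBC => ?_, fun ρ σ => canon_ri hK⟩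
    rw [Set.eq_empty_iff_forall_notMem]
    rintro ⟨a, w⟩ ⟨hB, hC⟩
    exact h ⟨(B, C), hBC⟩ ⟨a, w, mem_canon_semB.1 hB, mem_canon_semB.1 hC⟩

theorem ABox.canon_respects_iff {A : ABox} {hA : Nonempty A.ind} {Sc Sr : Set ℕ} :
    (A.canon T K hA).respects A Sc Sr ↔
      (∀ B : Sc, ¬ ∃ a : A.ind, ∃ w,
        ¬ (A.UB T K (.atom B) a w ↔ w = [] ∧ A.AB (.atom B) a)) ∧
      (∀ r : Sr, ¬ ∃ a b : A.ind, ∃ w : List Role × List Role,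
        ¬ (A.UR T K (.nm r) a w.1 b w.2 ↔ (w.1 = [] ∧ w.2 = []) ∧ A.AR (.nm r) a b)) := by
  simp only [not_exists, not_not, Subtype.forall (p := (· ∈ Sc)), Subtype.forall (p := (· ∈ Sr))]
  refine and_congr (forall₂_congr fun B hB => ?_) (forall₂_congr fun r hr => ?_)
  · have key : ∀ (a : A.ind) (w : List Role),
        (∃ a', (A.canon T K hA).ind a' = some (a, w) ∧ (B, a') ∈ A.ca) ↔
          w = [] ∧ A.AB (.atom B) a := by
      intro a w
      simp only [canon_ind_eq_some, AB]
      constructor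
      · rintro ⟨_, ⟨rfl, h₁⟩, h⟩
        exact ⟨h₁, h⟩
      · rintro ⟨h₁, h⟩
        exact ⟨a, ⟨rfl, h₁⟩, h⟩
    exact ⟨fun h a w => (h (a, w)).trans (key a w),
      fun h x => (h x.1 x.2).trans (key x.1 x.2).symm⟩
  · have key : ∀ (a b : A.ind) (w w' : List Role),
        (∃ a' b', (A.canon T K hA).ind a' = some (a, w) ∧ (A.canon T K hA).ind b' = some (b, w') ∧
          (r, a', b') ∈ A.ra) ↔ (w = [] ∧ w' = []) ∧ A.AR (.nm r) a b := by
      intro a b w w'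
      simp only [canon_ind_eq_some, AR]
      constructor
      · rintro ⟨_, _, ⟨rfl, h₁⟩, ⟨rfl, h₂⟩, h⟩
        exact ⟨⟨h₁, h₂⟩, h⟩
      · rintro ⟨⟨h₁, h₂⟩, h⟩
        exact ⟨a, b, ⟨rfl, h₁⟩, ⟨rfl, h₂⟩, h⟩
    exact ⟨fun h a b w => (h (a, w.1) (b, w.2)).trans (key a b w.1 w.2),
      fun h x y => (h x.1 y.1 (x.2, y.2)).trans (key x.1 y.1 x.2 y.2).symm⟩

theorem FODef.canon_model (hK : ∀ ax ∈ T, LiteAx.NamesLt K ax) {Sc Sr : Set ℕ}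
    (hSc : Sc.Finite) (hSr : Sr.Finite) :
    FODef ∅ fun A v =>
      (A.canon T K ⟨v 0⟩).modelLite T ∧ (A.canon T K ⟨v 0⟩).respects A Sc Sr := by
  have : Finite {ax // ax ∈ T} := (List.finite_toSet T).to_subtype
  have : Finite {p : Basic × Basic // LiteAx.npos p.1 p.2 ∈ T} :=
    Finite.of_injective (β := {ax // ax ∈ T}) (fun p => ⟨.npos p.1.1 p.1.2, p.2⟩)
      (by rintro ⟨⟨B, C⟩, _⟩ ⟨⟨B', C'⟩, _⟩ h; simpa using h)
  have := hSc.to_subtype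
  have := hSr.to_subtype
  refine FODef.congr ?_ fun A v =>
    (and_congr (ABox.canon_modelLite_iff T K hK) (ABox.canon_respects_iff T K)).symm
  refine (FODef.forall_finite
    fun p : {p : Basic × Basic // LiteAx.npos p.1 p.2 ∈ T} => (FODef.exists_ind
      (P := fun A a => ∃ w, A.UB T K p.1.1 a w ∧ A.UB T K p.1.2 a w) ?_).not).and
    ((FODef.forall_finite fun B : Sc => (FODef.exists_ind (P := fun A a => ∃ w,
        ¬ (A.UB T K (.atom B) a w ↔ w = [] ∧ A.AB (.atom B) a)) ?_).not).and
      (FODef.forall_finite fun r : Sr => (FODef.exists_ind₂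
        (P := fun A a b => ∃ w : List Role × List Role,
        ¬ (A.UR T K (.nm r) a w.1 b w.2 ↔ (w.1 = [] ∧ w.2 = []) ∧ A.AR (.nm r) a b)) ?_).not))
  · exact ((FinBased.UB T K id p.1.1 0).and (FinBased.UB T K id p.1.2 0)).foDef_exists
  · exact ((FinBased.UB T K id (.atom B) 0).iff ((FinBased.const fun w => w = []).and
      (FinBased.of_foDef (FODef.AB (.atom B) 0)))).not.foDef_exists
  · exact ((FinBased.UR T K Prod.fst Prod.snd (.nm r) 0 1).iff
      ((FinBased.const fun w => w.1 = [] ∧ w.2 = []).and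
        (FinBased.of_foDef (FODef.AR (.nm r) 0 1)))).not.foDef_exists

end Definability

/-! ### The empty ABox and the main result -/

/-- The one-point interpretation with empty predicates and no individual names. -/
def emptyInterp : Interp where
  Dom := Unit
  dne := inferInstance
  ind _ := none
  ind_inj _ _ _ h := by cases h
  cInt _ := ∅
  rInt _ := ∅

theorem emptyInterp_rI (ρ : Role) : emptyInterp.rI ρ = ∅ := by
  cases ρ <;> rfl

theorem emptyInterp_semB (B : Basic) : emptyInterp.semB B = ∅ := by
  cases B with
  | atom B => rfl
  | ex ρ => simp [Interp.semB, emptyInterp_rI]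

theorem emptyInterp_modelLite (T : LiteTBox) : emptyInterp.modelLite T := by
  simp [Interp.modelLite, emptyInterp_rI, emptyInterp_semB]

theorem not_emptyInterp_evalFO {q : FO} (hq : IsUCQ q) (v : ℕ → emptyInterp.Dom) :
    ¬ emptyInterp.evalFO v q := by
  have h₁ : ∀ {q}, IsConjAtoms q → ∀ v, ¬ emptyInterp.evalFO v q := by
    intro q hq v
    induction hq with
    | capp B x => exact id
    | rapp r x y => exact id
    | conj _ _ ih _ => exact fun h => ih h.1
  have h₂ : ∀ {q}, IsCQ q → ∀ v, ¬ emptyInterp.evalFO v q := by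
    intro q hq
    induction hq with
    | base hq => exact h₁ hq
    | ex x _ ih => exact fun v ⟨d, hd⟩ => ih _ hd
  induction hq with
  | base hq => exact h₂ hq v
  | disj _ _ ih₁ ih₂ => exact fun h => h.elim ih₁ ih₂

theorem ABox.not_certAns_of_isEmpty {A : ABox} (hA : ¬ Nonempty A.ind) (T : LiteTBox)
    (Sc Sr : Set ℕ) {q : FO} (hq : IsUCQ q) (xs as : List ℕ) :
    ¬ certAns (fun I => I.modelLite T) Sc Sr A q xs as := by
  intro h
  have hca : ∀ p, p ∉ A.ca := fun p hp => hA ⟨p.2, .inl ⟨p, hp, rfl⟩⟩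
  have hra : ∀ t, t ∉ A.ra := fun t ht => hA ⟨t.2.1, .inr ⟨t, ht, .inl rfl⟩⟩
  obtain ⟨v, -, hv⟩ := h emptyInterp (emptyInterp_modelLite T)
    ⟨fun p hp => absurd hp (hca p), fun t ht => absurd ht (hra t)⟩
    ⟨fun B _ d => ⟨fun h => h.elim, fun ⟨_, _, h⟩ => absurd h (hca _)⟩,
      fun r _ d e => ⟨fun h => h.elim, fun ⟨_, _, _, _, h⟩ => absurd h (hra _)⟩⟩
  exact not_emptyInterp_evalFO hq v hv

/-- A bound for the names constrained by `LiteAx.NamesLt`. -/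
def LiteAx.weight : LiteAx → ℕ
  | .pos B C => B.nm + C.nm
  | .npos B C => B.nm + C.nm
  | .ri ρ σ => ρ.name + σ.name

theorem exists_names_lt (T : LiteTBox) {Sr : Set ℕ} (hSr : Sr.Finite) :
    ∃ K, (∀ ax ∈ T, LiteAx.NamesLt K ax) ∧ ∀ r ∈ Sr, r < K := by
  obtain ⟨L, hL⟩ := hSr.bddAbove
  have hf : ∀ ax ∈ T, ax.weight ≤ (T.map LiteAx.weight).sum :=
    fun ax hax => List.le_sum_of_mem (List.mem_map_of_mem hax)
  refine ⟨(T.map LiteAx.weight).sum + L + 1, fun ax hax => ?_, fun r hr => ?_⟩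
  · have := hf ax hax
    cases ax <;> simp only [LiteAx.weight] at this <;> simp only [LiteAx.NamesLt] <;> omega
  · have := hL hr
    omega

theorem exists_assignment {α : Type} [Nonempty α] {xs : List ℕ} (hxs : xs.Nodup) (as : List α) :
    ∃ v : ℕ → α, ∀ p ∈ List.zip xs as, v p.1 = p.2 := by
  induction xs generalizing as with
  | nil => exact ⟨fun _ => Classical.arbitrary α, by simp⟩
  | cons x xs ih =>
    cases as with
    | nil => exact ⟨fun _ => Classical.arbitrary α, by simp⟩
    | cons a as =>
      obtain ⟨hx, hxs⟩ := List.nodup_cons.1 hxs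
      obtain ⟨v, hv⟩ := ih hxs as
      refine ⟨Function.update v x a, fun p hp => ?_⟩
      rcases List.mem_cons.1 (List.zip_cons_cons ▸ hp) with rfl | hp
      · simp
      · have hne : p.1 ≠ x := fun h => hx (h ▸ (List.of_mem_zip hp).1)
        rw [Function.update_of_ne hne, hv p hp]

theorem exists_mem_zip {xs as : List ℕ} (h : as.length = xs.length) {x : ℕ} (hx : x ∈ xs) :
    ∃ a ∈ as, (x, a) ∈ List.zip xs as := by
  obtain ⟨i, hi, rfl⟩ := List.getElem_of_mem hx
  exact ⟨as[i], List.getElem_mem _, List.mem_iff_getElem.2 ⟨i, by simp [h, hi], by simp⟩⟩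

/-- Let `(T, S_C)` be a safe DL-Lite_R TBox with closed
predicates.  Then for every UCQ `q(xs)`, the OMQC `(T, S_C, q)` (with
unrestricted ABox signature) is FO-rewritable. -/
theorem statement_7 (T : LiteTBox) (Sc Sr : Set ℕ)
    (hfin : Sc.Finite ∧ Sr.Finite) (hsafe : LiteSafe T Sc Sr)
    (q : FO) (hq : IsUCQ q) (xs : List ℕ) (hfree : q.free ⊆ {x | x ∈ xs})
    (hnodup : xs.Nodup) :
    FORewritable (fun A as => certAns (fun I => I.modelLite T) Sc Sr A q xs as)
      (fun A => A.Fin) xs := by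
  obtain ⟨K, hK, hSr⟩ := exists_names_lt T hfin.2
  obtain ⟨p, hp, hpe⟩ :=
    (((FODef.canon_model T K hK hfin.1 hfin.2).mono (Set.empty_subset {x | x ∈ xs})).not.or
      ((FODef.ucq T K hq {w | ∀ x ∈ xs, w x = []}).mono hfree))
  refine ⟨.conj (.ex 0 (.eq 0 0)) p, by simpa [FO.free] using hp, fun A _ as hlen has => ?_⟩
  by_cases hA : Nonempty A.ind
  swap
  · refine iff_of_false ?_ (ABox.not_certAns_of_isEmpty hA T Sc Sr hq xs as)
    rintro ⟨v, -, ⟨a, ha, -⟩, -⟩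
    exact hA ⟨a, ha⟩
  refine Iff.trans ?_ (ABox.certAns_iff_canon (hA := hA) hsafe hK hSr hq xs as).symm
  constructor
  · rintro ⟨v, hv, -, hvp⟩ hgood
    have hvxs : ∀ x ∈ xs, v x ∈ A.ind := by
      intro x hx
      obtain ⟨a, ha, hxa⟩ := exists_mem_zip hlen hx
      rw [hv _ hxa]
      exact has a ha
    classical
    let v' : ℕ → A.ind := fun x => if h : v x ∈ A.ind then ⟨v x, h⟩ else hA.some
    have hv' : ∀ x ∈ xs, v x = v' x := fun x hx => by simp only [v', dif_pos (hvxs x hx)]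
    rw [A.evalFO_congr p fun x hx => hv' x (hp hx), hpe A v'] at hvp
    obtain ⟨w, hw, hwq⟩ := hvp.resolve_left (not_not.2 hgood)
    refine ⟨fun x => (v' x, w x), fun pr hpr => ABox.canon_ind_eq_some.2 ?_, hwq⟩
    have hx := (List.of_mem_zip hpr).1
    exact ⟨(hv pr hpr).symm.trans (hv' _ hx), hw _ hx⟩
  · intro h
    suffices ∃ v : ℕ → A.ind, (∀ pr ∈ List.zip xs as, (v pr.1 : ℕ) = pr.2) ∧
        A.evalFO (fun x => (v x : ℕ)) p by
      obtain ⟨v, hv, hvp⟩ := this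
      exact ⟨fun x => v x, hv, ⟨hA.some, hA.some.2, rfl⟩, hvp⟩
    by_cases hgood : (A.canon T K hA).modelLite T ∧ (A.canon T K hA).respects A Sc Sr
    · obtain ⟨v, hv, hvq⟩ := h hgood
      have hv' := fun pr hpr => ABox.canon_ind_eq_some.1 (hv pr hpr)
      refine ⟨fun x => (v x).1, fun pr hpr => (hv' pr hpr).1.symm,
        (hpe A _).2 (.inr ⟨fun x => (v x).2, fun x hx => ?_, hvq⟩)⟩
      obtain ⟨a, -, hxa⟩ := exists_mem_zip hlen hx
      exact (hv' _ hxa).2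
    · obtain ⟨v, hv⟩ := exists_assignment hnodup as
      have hvxs : ∀ x ∈ xs, v x ∈ A.ind := by
        intro x hx
        obtain ⟨a, ha, hxa⟩ := exists_mem_zip hlen hx
        rw [hv _ hxa]
        exact has a ha
      classical
      refine ⟨fun x => if h : v x ∈ A.ind then ⟨v x, h⟩ else hA.some, fun pr hpr => ?_,
        (hpe A _).2 (.inl hgood)⟩
      beta_reduce
      rw [dif_pos (hvxs _ (List.of_mem_zip hpr).1)]
      exact hv pr hpr

end DL
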